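/- Let n > 1, ℓ > 0 and b ≥ 0, and set ε = ⌊b/ℓ⌋/(n−1) − 1/n. For any real numbers U_(1) ≤ ... ≤ U_(n−1) in [0,1], if U_(k) < ((k+1) − b/ℓ)/n for some k with max(1, ⌊b/ℓ⌋) ≤ k ≤ n−1, then U_(k') < k'/(n−1) − ε for some k' ∈ {1,...,n−1}; equivalently, the event E = ⋃_{k=⌊b/ℓ⌋}^{n−1} { U_(k) < ((k+1) − b/ℓ)/n } is contained in the event E'(ε) = ⋃_{k=1}^{n−1} { U_(k) < k/(n−1) − ε }. -/

import Mathlib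

/-- **Step 2 of the proof of Theorem 1.** Let `n > 1`, `ℓ > 0`, `b ≥ 0`, and set
`ε = ⌊b/ℓ⌋/(n−1) − 1/n`. For any real numbers `U_(1) ≤ … ≤ U_(n−1)` in `[0,1]`
(represented by the monotone family `V`, with `U_(k) = V j` for `k = j + 1`),
if `U_(k) < ((k+1) − b/ℓ)/n` for some `k` with `max(1,⌊b/ℓ⌋) ≤ k ≤ n−1`, then
`U_(k') < k'/(n−1) − ε` for some `k' ∈ {1,…,n−1}`; i.e. the event `E` is contained
in the event `E'(ε)`. -/
theorem event_E_subset_event_E'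
    (n : ℕ) (hn : 1 < n) (ℓ b : ℝ) (hℓ : 0 < ℓ) (hb : 0 ≤ b)
    (ε : ℝ) (hε : ε = (⌊b / ℓ⌋ : ℝ) / ((n : ℝ) - 1) - 1 / n)
    (V : Fin (n - 1) → ℝ) (hVmono : Monotone V) (hVmem : ∀ j, V j ∈ Set.Icc (0:ℝ) 1)
    (hE : ∃ j : Fin (n - 1), ⌊b / ℓ⌋ ≤ (j : ℤ) + 1 ∧
      V j < (((j : ℕ) : ℝ) + 1 + 1 - b / ℓ) / n) :
    ∃ j : Fin (n - 1), V j < (((j : ℕ) : ℝ) + 1) / ((n : ℝ) - 1) - ε := by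
  obtain ⟨j, hj, hV⟩ := hE
  refine ⟨j, lt_of_lt_of_le hV ?_⟩
  have hfl : (⌊b / ℓ⌋ : ℝ) ≤ b / ℓ := Int.floor_le _
  have hj' : (⌊b / ℓ⌋ : ℝ) ≤ ((j : ℕ) : ℝ) + 1 := by exact_mod_cast hj
  have hn' : (1 : ℝ) < n := by exact_mod_cast hn
  have h1 : (((j : ℕ) : ℝ) + 1 - b / ℓ) / n ≤ (((j : ℕ) : ℝ) + 1 - ⌊b / ℓ⌋) / n := by
    gcongr
  have h2 : (((j : ℕ) : ℝ) + 1 - ⌊b / ℓ⌋) / n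
      ≤ (((j : ℕ) : ℝ) + 1 - ⌊b / ℓ⌋) / ((n : ℝ) - 1) :=
    div_le_div_of_nonneg_left (by linarith) (by linarith) (by linarith)
  have e1 : (((j : ℕ) : ℝ) + 1 + 1 - b / ℓ) / n
      = (((j : ℕ) : ℝ) + 1 - b / ℓ) / n + 1 / n := by ring
  have e2 : (((j : ℕ) : ℝ) + 1) / ((n : ℝ) - 1) - ε
      = (((j : ℕ) : ℝ) + 1 - ⌊b / ℓ⌋) / ((n : ℝ) - 1) + 1 / n := by
    rw [hε]; ring
  rw [e1, e2]
  linarith
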